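/- Fix x0 ∈ ℝ, s ∈ ℝ, s' ∈ ℝ, σ > 0, σ' > 0, and τ with 0 < τ ≤ σ'. Define p(x) = φ(x; s·x0, σ²) and q(y, x) = φ(y; s'·x0 + (Real.sqrt (σ'² − τ²)/σ)·(x − s·x0), τ²). Then for every y ∈ ℝ, ∫ q(y, x)·p(x) dx = φ(y; s'·x0, σ'²). In other words, the DDIM reverse kernel maps the prescribed Gaussian marginal at time t to the prescribed Gaussian marginal at time t−dt. -/

import Mathlib

open Real MeasureTheory

/-- Gaussian probability density with mean `m` and variance `v`. -/
noncomputable def gaussianPDF (m v x : ℝ) : ℝ :=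
  (2 * Real.pi * v) ^ (-(1 : ℝ) / 2) * Real.exp (-(x - m) ^ 2 / (2 * v))

/-- A Gaussian density with positive variance has total mass one. -/
lemma integral_gaussianPDF_eq_one (m : ℝ) {v : ℝ} (hv : 0 < v) :
    ∫ x, gaussianPDF m v x = 1 := by
  lift v to NNReal using hv.le
  rw [← ProbabilityTheory.integral_gaussianPDFReal_eq_one m (NNReal.coe_pos.1 hv).ne']
  congr 1 with x
  rw [gaussianPDF, ProbabilityTheory.gaussianPDFReal, Real.sqrt_eq_rpow,
    ← Real.rpow_neg (by positivity), neg_div]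

/-- Factorization of a linear-Gaussian joint density into the marginal of `y` and the
posterior of `x` given `y`. -/
lemma gaussianPDF_mul_gaussianPDF (a b m x y : ℝ) {t v : ℝ} (ht : 0 < t) (hv : 0 < v) :
    gaussianPDF (b + a * (x - m)) t y * gaussianPDF m v x =
      gaussianPDF b (a ^ 2 * v + t) y *
        gaussianPDF (m + a * v * (y - b) / (a ^ 2 * v + t)) (v * t / (a ^ 2 * v + t)) x := by
  have hw : 0 < a ^ 2 * v + t := by positivity
  simp only [gaussianPDF]
  rw [mul_mul_mul_comm, mul_mul_mul_comm ((2 * π * (a ^ 2 * v + t)) ^ _),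
    ← Real.mul_rpow (by positivity) (by positivity),
    ← Real.mul_rpow (by positivity) (by positivity), ← Real.exp_add, ← Real.exp_add]
  congr 2
  · field_simp
  · field_simp
    ring

/-- The DDIM reverse kernel maps the prescribed Gaussian marginal at time `t`
to the prescribed Gaussian marginal at time `t − dt`. -/
theorem ddim_marginal_consistency (x0 s s' σ σ' τ : ℝ)
    (hσ : 0 < σ) (hσ' : 0 < σ') (hτ0 : 0 < τ) (hτ : τ ≤ σ')
    (p : ℝ → ℝ) (q : ℝ → ℝ → ℝ)
    (hp : ∀ x, p x = gaussianPDF (s * x0) (σ ^ 2) x)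
    (hq : ∀ y x, q y x =
      gaussianPDF (s' * x0 + (Real.sqrt (σ' ^ 2 - τ ^ 2) / σ) * (x - s * x0)) (τ ^ 2) y) :
    ∀ y : ℝ, ∫ x : ℝ, q y x * p x = gaussianPDF (s' * x0) (σ' ^ 2) y := by
  intro y
  have hvar : (√(σ' ^ 2 - τ ^ 2) / σ) ^ 2 * σ ^ 2 + τ ^ 2 = σ' ^ 2 := by
    rw [div_pow, Real.sq_sqrt (sub_nonneg.2 (pow_le_pow_left₀ hτ0.le hτ 2)),
      div_mul_cancel₀ _ (by positivity), sub_add_cancel]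
  simp_rw [hp, hq, gaussianPDF_mul_gaussianPDF _ _ _ _ _ (pow_pos hτ0 2) (pow_pos hσ 2), hvar]
  rw [integral_const_mul, integral_gaussianPDF_eq_one _ (by positivity), mul_one]
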